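/- arXiv:1601.00333 — 3 statements merged into one kernel-verified Lean document; each statement's English description precedes it below -/
import Mathlib

section
/- (Stone–von Neumann, existence) Let H be a group whose commutator subgroup [H,H] is contained in its center Z(H) and such that H/Z(H) is finite. Let χ : Z(H) → ℂ^× be a group homomorphism with ker(χ) ∩ [H,H] = {1}. Let A be a maximal abelian subgroup of H (necessarily Z(H) ≤ A, and A has finite index in H), and let χ₀ : A → ℂ^× be a homomorphism extending χ. Then the representation of H by right translation on V = {f : H → ℂ | f(ah) = χ₀(a) f(h) for all a ∈ A, h ∈ H} is irreducible, has dimension [H : A], and every z ∈ Z(H) acts on V by the scalar χ(z). -/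
noncomputable section

/-- the space of the representation of `H` induced from the character `χ0` of `A`:
functions `f : H → ℂ` with `f (a * h) = χ0 a * f h`, with `H` acting by right translation -/
def indV (H : Type) [Group H] (A : Subgroup H) (χ0 : A →* ℂˣ) : Submodule ℂ (H → ℂ) where
  carrier := {f | ∀ (a : A) (h : H), f (↑a * h) = (χ0 a : ℂ) * f h}
  add_mem' := by
    intro f g hf hg a h
    simp only [Pi.add_apply, hf a h, hg a h]
    ring
  zero_mem' := by intro a h; simp
  smul_mem' := by
    intro c f hf a h
    simp only [Pi.smul_apply, smul_eq_mul, hf a h]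
    ring

/-- A subgroup that is maximal among commutative subgroups contains its centralizer. -/
theorem mem_of_commute_of_maximal {H : Type} [Group H] {A : Subgroup H}
    (hab : ∀ x ∈ A, ∀ y ∈ A, x * y = y * x)
    (hmax : ∀ B : Subgroup H, A ≤ B → (∀ x ∈ B, ∀ y ∈ B, x * y = y * x) → B = A)
    {k : H} (hk : ∀ b ∈ A, k * b = b * k) : k ∈ A := by
  have hcl : ∀ x ∈ Subgroup.closure (insert k (A : Set H)),
      ∀ y ∈ Subgroup.closure (insert k (A : Set H)), x * y = y * x := by
    intro x hx y hy
    have hS : ∀ x ∈ insert k (A : Set H), ∀ y ∈ insert k (A : Set H), x * y = y * x := by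
      rintro u (rfl | hu) v (rfl | hv)
      · rfl
      · exact hk v hv
      · exact (hk u hu).symm
      · exact hab u hu v hv
    have := Subgroup.isMulCommutative_closure hS
    exact congrArg Subtype.val (mul_comm' (⟨x, hx⟩ : Subgroup.closure _) ⟨y, hy⟩)
  rw [← hmax _ (fun a ha => Subgroup.subset_closure (Set.mem_insert_of_mem k ha)) hcl]
  exact Subgroup.subset_closure (Set.mem_insert k _)

open scoped commutatorElement in
/-- A subgroup containing the commutator subgroup is normal. -/
theorem normal_of_commutator_le {H : Type} [Group H] {A : Subgroup H}
    (h : commutator H ≤ A) : A.Normal where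
  conj_mem a ha g := by
    have hg : ⁅g, a⁆ ∈ A := h (Subgroup.commutator_mem_commutator (Subgroup.mem_top g) (Subgroup.mem_top a))
    simpa [commutatorElement_def] using A.mul_mem hg ha

open scoped commutatorElement in
/-- A character of a maximal commutative subgroup `A` that is injective on central commutators
is moved by every element outside `A`. -/
theorem exists_conj_ne_of_maximal {H : Type} [Group H]
    (hcomm : commutator H ≤ Subgroup.center H) (χ : Subgroup.center H →* ℂˣ)
    (hker : ∀ z : Subgroup.center H, (z : H) ∈ commutator H → χ z = 1 → z = 1)
    {A : Subgroup H} (hab : ∀ x ∈ A, ∀ y ∈ A, x * y = y * x)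
    (hmax : ∀ B : Subgroup H, A ≤ B → (∀ x ∈ B, ∀ y ∈ B, x * y = y * x) → B = A)
    (hZA : Subgroup.center H ≤ A) {χ0 : A →* ℂˣ}
    (hext : ∀ z : Subgroup.center H, χ0 ⟨z, hZA z.2⟩ = χ z) (hA : A.Normal) :
    ∀ k ∉ A, ∃ b : A, χ0 ⟨k * b * k⁻¹, hA.conj_mem b b.2 k⟩ ≠ χ0 b := by
  intro k hk
  by_contra! h
  refine hk (mem_of_commute_of_maximal hab hmax fun b hb => ?_)
  have hc : ⁅k, b⁆ ∈ commutator H :=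
    Subgroup.commutator_mem_commutator (Subgroup.mem_top k) (Subgroup.mem_top b)
  have hz := hker ⟨⁅k, b⁆, hcomm hc⟩ hc (by
    have hx : (⟨⁅k, b⁆, hZA (hcomm hc)⟩ : A) =
        ⟨k * b * k⁻¹, hA.conj_mem b hb k⟩ * ⟨b, hb⟩⁻¹ := rfl
    rw [← hext, hx, map_mul, map_inv, h ⟨b, hb⟩, mul_inv_cancel])
  exact commutatorElement_eq_one_iff_mul_comm.mp (congrArg Subtype.val hz)

section Induced

variable {H : Type} [Group H] {A : Subgroup H} {χ0 : A →* ℂˣ}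

theorem indV_apply_mul {f : H → ℂ} (hf : f ∈ indV H A χ0) {a : H} (ha : a ∈ A) (h : H) :
    f (a * h) = (χ0 ⟨a, ha⟩ : ℂ) * f h :=
  hf ⟨a, ha⟩ h

theorem indV_apply_mul_right (hA : A.Normal) {f : H → ℂ} (hf : f ∈ indV H A χ0)
    {a : H} (ha : a ∈ A) (h : H) :
    f (h * a) = (χ0 ⟨h * a * h⁻¹, hA.conj_mem a ha h⟩ : ℂ) * f h := by
  rw [← indV_apply_mul hf]
  congr 1
  group

variable (A) in
/-- The chosen representative of the right coset `A h`. -/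
def rightRep (h : H) : H :=
  (Quotient.mk (QuotientGroup.rightRel A) h).out

theorem mul_rightRep_inv_mem (h : H) : h * (rightRep A h)⁻¹ ∈ A :=
  QuotientGroup.rightRel_apply.mp (Quotient.mk_out (s := QuotientGroup.rightRel A) h)

theorem mk_mul_eq_mk (a : A) (h : H) :
    Quotient.mk (QuotientGroup.rightRel A) (a * h) = Quotient.mk (QuotientGroup.rightRel A) h := by
  refine Quotient.sound (QuotientGroup.rightRel_apply.mpr ?_)
  simp

variable (A χ0) in
/-- An element of the induced representation is determined by its values on coset
representatives, which may be prescribed arbitrarily. -/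
def indVEquiv :
    indV H A χ0 ≃ₗ[ℂ] (Quotient (QuotientGroup.rightRel A) → ℂ) where
  toFun f q := f.1 q.out
  map_add' _ _ := rfl
  map_smul' _ _ := rfl
  invFun c := ⟨fun h => (χ0 ⟨h * (rightRep A h)⁻¹, mul_rightRep_inv_mem h⟩ : ℂ) *
      c (Quotient.mk _ h), by
    intro a h
    have hr : rightRep A (a * h) = rightRep A h := by
      rw [rightRep, mk_mul_eq_mk, rightRep]
    have hx : (⟨a * h * (rightRep A (a * h))⁻¹, mul_rightRep_inv_mem _⟩ : A) =
        a * ⟨h * (rightRep A h)⁻¹, mul_rightRep_inv_mem h⟩ := by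
      ext
      simp [hr, mul_assoc]
    beta_reduce
    rw [hx, mk_mul_eq_mk, map_mul, Units.val_mul, mul_assoc]⟩
  left_inv f := by
    ext h
    change _ * f.1 (rightRep A h) = f.1 h
    rw [← indV_apply_mul f.2, inv_mul_cancel_right]
  right_inv c := by
    ext q
    have hx : (⟨q.out * (rightRep A q.out)⁻¹, mul_rightRep_inv_mem q.out⟩ : A) = 1 := by
      ext
      simp [rightRep]
    simp [hx]

theorem indV_ext {f g : H → ℂ} (hf : f ∈ indV H A χ0) (hg : g ∈ indV H A χ0)
    (h : ∀ q : Quotient (QuotientGroup.rightRel A), f q.out = g q.out) : f = g :=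
  congrArg Subtype.val ((indVEquiv A χ0).injective
    (a₁ := ⟨f, hf⟩) (a₂ := ⟨g, hg⟩) (funext h))

theorem finrank_indV [A.FiniteIndex] : Module.finrank ℂ (indV H A χ0) = A.index := by
  have e := QuotientGroup.quotientRightRelEquivQuotientLeftRel A
  have : Finite (Quotient (QuotientGroup.rightRel A)) := Finite.of_equiv _ e.symm
  have := Fintype.ofFinite (Quotient (QuotientGroup.rightRel A))
  rw [(indVEquiv A χ0).finrank_eq, Module.finrank_fintype_fun_eq_card, ← Nat.card_eq_fintype_card,
    Nat.card_congr e, Subgroup.index]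

variable {W : Submodule ℂ (H → ℂ)}

/-- If the conjugates of `χ0` by elements outside `A` differ from `χ0`, then an invariant subspace
containing a function that does not vanish at `h0` contains one which is `1` at `h0` and vanishes
at any finite set of points outside the coset `A h0`. -/
theorem exists_mem_eq_one_forall_eq_zero (hA : A.Normal)
    (hsep : ∀ k ∉ A, ∃ b : A, χ0 ⟨k * b * k⁻¹, hA.conj_mem b b.2 k⟩ ≠ χ0 b)
    (hWV : W ≤ indV H A χ0)
    (hW : ∀ (k : H) (f : H → ℂ), f ∈ W → (fun x => f (x * k)) ∈ W)
    {f : H → ℂ} (hf : f ∈ W) {h0 : H} (h0f : f h0 ≠ 0) (S : Finset H)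
    (hS : ∀ s ∈ S, h0 * s⁻¹ ∉ A) :
    ∃ g ∈ W, g h0 = 1 ∧ ∀ s ∈ S, g s = 0 := by
  classical
  induction S using Finset.induction_on with
  | empty => exact ⟨(f h0)⁻¹ • f, W.smul_mem _ hf, by simp [h0f], by simp⟩
  | insert s S _ ih =>
    obtain ⟨g, hg, hg1, hg0⟩ := ih fun t ht => hS t (Finset.mem_insert_of_mem ht)
    obtain ⟨b, hb⟩ := hsep _ (hS s (Finset.mem_insert_self s S))
    set k := h0 * s⁻¹ with hk
    set c : ℂ := (χ0 ⟨k * b * k⁻¹, hA.conj_mem b b.2 k⟩ : ℂ) - χ0 b with hc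
    have hc0 : c ≠ 0 := sub_ne_zero.mpr fun h => hb (Units.ext h)
    have ha : s⁻¹ * b * s ∈ A := by simpa using hA.conj_mem b b.2 s⁻¹
    refine ⟨c⁻¹ • ((fun x => g (x * (s⁻¹ * b * s))) - (χ0 b : ℂ) • g),
      W.smul_mem _ (W.sub_mem (hW _ g hg) (W.smul_mem _ hg)), ?_, ?_⟩
    · have h1 : h0 * (s⁻¹ * b * s) = k * b * k⁻¹ * h0 := by rw [hk]; group
      simp only [Pi.smul_apply, Pi.sub_apply, h1, smul_eq_mul]
      rw [indV_apply_mul (hWV hg) (hA.conj_mem b b.2 k), hg1, mul_one, mul_one, ← hc,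
        inv_mul_cancel₀ hc0]
    · intro t ht
      rcases Finset.mem_insert.mp ht with rfl | ht
      · have h1 : t * (t⁻¹ * b * t) = b * t := by group
        simp only [Pi.smul_apply, Pi.sub_apply, h1, smul_eq_mul]
        rw [indV_apply_mul (hWV hg) b.2, sub_self, mul_zero]
      · simp only [Pi.smul_apply, Pi.sub_apply, smul_eq_mul]
        rw [indV_apply_mul_right hA (hWV hg) ha, hg0 t ht]
        simp

/-- Mackey's irreducibility criterion for a character of a normal subgroup of finite index. -/
theorem indV_irreducible [A.FiniteIndex] (hA : A.Normal)
    (hsep : ∀ k ∉ A, ∃ b : A, χ0 ⟨k * b * k⁻¹, hA.conj_mem b b.2 k⟩ ≠ χ0 b)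
    (hWV : W ≤ indV H A χ0)
    (hW : ∀ (k : H) (f : H → ℂ), f ∈ W → (fun x => f (x * k)) ∈ W) :
    W = ⊥ ∨ W = indV H A χ0 := by
  classical
  refine or_iff_not_imp_left.mpr fun hbot => le_antisymm hWV fun F hF => ?_
  obtain ⟨f, hf, hf0⟩ := W.ne_bot_iff.mp hbot
  obtain ⟨h0, h0f⟩ := Function.ne_iff.mp hf0
  have : Finite (Quotient (QuotientGroup.rightRel A)) :=
    Finite.of_equiv _ (QuotientGroup.quotientRightRelEquivQuotientLeftRel A).symm
  have := Fintype.ofFinite (Quotient (QuotientGroup.rightRel A))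
  obtain ⟨g, hg, hg1, hg0⟩ := exists_mem_eq_one_forall_eq_zero hA hsep hWV hW hf h0f
    (((Finset.univ : Finset (Quotient (QuotientGroup.rightRel A))).image Quotient.out).filter
      fun s => h0 * s⁻¹ ∉ A) fun s hs => (Finset.mem_filter.mp hs).2
  have hsupp : ∀ x, x * h0⁻¹ ∉ A → g x = 0 := by
    intro x hx
    have hxr := mul_rightRep_inv_mem (A := A) x
    rw [← inv_mul_cancel_right x (rightRep A x), indV_apply_mul (hWV hg) hxr,
      hg0 (rightRep A x) (Finset.mem_filter.mpr
        ⟨Finset.mem_image_of_mem _ (Finset.mem_univ _), fun h => hx ?_⟩), mul_zero]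
    simpa using A.mul_mem hxr (A.inv_mem h)
  have hmem : ∑ q : Quotient (QuotientGroup.rightRel A),
      F q.out • (fun x => g (x * (q.out⁻¹ * h0))) ∈ W :=
    W.sum_mem fun q _ => W.smul_mem _ (hW _ g hg)
  rw [indV_ext hF (hWV hmem) fun p => ?_]
  · exact hmem
  · rw [Finset.sum_apply, Finset.sum_eq_single p]
    · simp [hg1]
    · intro q _ hqp
      have : g (p.out * (q.out⁻¹ * h0)) = 0 := by
        refine hsupp _ fun h => hqp ?_
        rw [← q.out_eq, ← p.out_eq]
        refine Quotient.sound (QuotientGroup.rightRel_apply.mpr ?_)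
        simpa [mul_assoc] using h
      simp [this]
    · simp

end Induced

/-- **Statement 8** (Stone-von Neumann, existence). Let `H` be a group whose commutator
subgroup is contained in its center and with `H/Z(H)` finite. Let `χ : Z(H) → ℂˣ` be a
homomorphism with `ker χ ∩ [H,H] = 1`. Let `A` be a maximal abelian subgroup of `H`
(necessarily `Z(H) ≤ A`) and `χ₀ : A → ℂˣ` a homomorphism extending `χ`. Then the
representation of `H` by right translation on
`V = {f : H → ℂ | f(ah) = χ₀(a) f(h)}` is irreducible, has dimension `[H : A]`, and every
`z ∈ Z(H)` acts on `V` by the scalar `χ(z)`. -/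
theorem stone_von_neumann_existence (H : Type) [Group H]
    (hcomm : commutator H ≤ Subgroup.center H)
    (hfin : Finite (H ⧸ Subgroup.center H))
    (χ : ↥(Subgroup.center H) →* ℂˣ)
    (hker : ∀ z : Subgroup.center H, (z : H) ∈ commutator H → χ z = 1 → z = 1)
    (A : Subgroup H)
    (hab : ∀ x ∈ A, ∀ y ∈ A, x * y = y * x)
    (hmax : ∀ B : Subgroup H, A ≤ B → (∀ x ∈ B, ∀ y ∈ B, x * y = y * x) → B = A)
    (hZA : Subgroup.center H ≤ A)
    (χ0 : A →* ℂˣ)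
    (hext : ∀ z : Subgroup.center H, χ0 ⟨↑z, hZA z.2⟩ = χ z) :
    indV H A χ0 ≠ ⊥ ∧
    (∀ W : Submodule ℂ (H → ℂ), W ≤ indV H A χ0 →
      (∀ (k : H) (f : H → ℂ), f ∈ W → (fun x => f (x * k)) ∈ W) →
      W = ⊥ ∨ W = indV H A χ0) ∧
    Module.finrank ℂ ↥(indV H A χ0) = A.index ∧
    (∀ (z : Subgroup.center H) (f : H → ℂ), f ∈ indV H A χ0 →
      (fun x => f (x * ↑z)) = (χ z : ℂ) • f) := by
  have hA : A.Normal := normal_of_commutator_le (hcomm.trans hZA)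
  have : (Subgroup.center H).FiniteIndex := Subgroup.finiteIndex_of_finite_quotient
  have : A.FiniteIndex := Subgroup.finiteIndex_of_le hZA
  have hsep := exists_conj_ne_of_maximal hcomm χ hker hab hmax hZA hext hA
  refine ⟨fun h => ?_, fun W hWV hW => indV_irreducible hA hsep hWV hW, finrank_indV, ?_⟩
  · have hr := finrank_indV (χ0 := χ0)
    rw [h, finrank_bot] at hr
    exact Subgroup.FiniteIndex.index_ne_zero hr.symm
  · intro z f hf
    ext x
    rw [Subgroup.mem_center_iff.mp z.2 x, indV_apply_mul hf (hZA z.2), hext]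
    rfl
end
end

section
/- (Stone–von Neumann, uniqueness) Let H be a group whose commutator subgroup [H,H] is contained in its center Z(H) and such that H/Z(H) is finite, and let χ : Z(H) → ℂ^× be a group homomorphism with ker(χ) ∩ [H,H] = {1}. Then any two irreducible complex representations of H on which Z(H) acts by the scalar χ are isomorphic as H-representations. -/
noncomputable section

section

open scoped commutatorElement

theorem commutatorElement_mem_commutator {H : Type*} [Group H] (g h : H) :
    ⁅g, h⁆ ∈ commutator H :=
  Subgroup.commutator_mem_commutator (Subgroup.mem_top g) (Subgroup.mem_top h)

/-- In a group whose commutators are central, a character of the center turns commutation with a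
fixed element into a character of the group. -/
def commutatorCharacter {H : Type*} [Group H] (hcomm : commutator H ≤ Subgroup.center H)
    (χ : Subgroup.center H →* ℂˣ) (s : H) : H →* ℂ where
  toFun h := χ ⟨⁅h, s⁆, hcomm (commutatorElement_mem_commutator h s)⟩
  map_one' := by
    have : (⟨⁅(1 : H), s⁆, hcomm (commutatorElement_mem_commutator 1 s)⟩ : Subgroup.center H) = 1 :=
      Subtype.ext (commutatorElement_one_left s)
    rw [this, map_one, Units.val_one]
  map_mul' g h := by
    rw [← Units.val_mul, ← map_mul]
    congr 2
    ext
    have hc := Subgroup.mem_center_iff.mp (hcomm (commutatorElement_mem_commutator h s)) g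
    have hc' := Subgroup.mem_center_iff.mp (hcomm (commutatorElement_mem_commutator h s)) ⁅g, s⁆
    calc ⁅g * h, s⁆ = (g * ⁅h, s⁆) * g⁻¹ * ⁅g, s⁆ := by simp only [commutatorElement_def]; group
      _ = ⁅h, s⁆ * ⁅g, s⁆ := by rw [hc]; group
      _ = ⁅g, s⁆ * ⁅h, s⁆ := hc'.symm

/-- If `χ` is faithful on commutators, then `commutatorCharacter` separates cosets of the
center. -/
theorem mk_eq_mk_of_commutatorCharacter_eq {H : Type*} [Group H]
    (hcomm : commutator H ≤ Subgroup.center H) (χ : Subgroup.center H →* ℂˣ)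
    (hker : ∀ z : Subgroup.center H, (z : H) ∈ commutator H → χ z = 1 → z = 1) {s t : H}
    (hst : commutatorCharacter hcomm χ s = commutatorCharacter hcomm χ t) :
    (s : H ⧸ Subgroup.center H) = t := by
  rw [QuotientGroup.eq, Subgroup.mem_center_iff]
  intro g
  have mem := commutatorElement_mem_commutator g
  have hg : χ ⟨_, hcomm (mem s)⟩ = χ ⟨_, hcomm (mem t)⟩ := Units.ext (DFunLike.congr_fun hst g)
  have hz := hker (⟨_, hcomm (mem s)⟩⁻¹ * ⟨_, hcomm (mem t)⟩)
    (mul_mem (inv_mem (mem s)) (mem t)) (by rw [map_mul, map_inv, hg, inv_mul_cancel])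
  have he : ⁅g, s⁆ = ⁅g, t⁆ := congrArg Subtype.val (inv_mul_eq_one.mp hz)
  have h1 : g * s * g⁻¹ = ⁅g, s⁆ * s := by simp [commutatorElement_def]
  have h2 : g * t * g⁻¹ = ⁅g, s⁆ * t := by rw [he]; simp [commutatorElement_def]
  have h3 : g * (s⁻¹ * t) * g⁻¹ = s⁻¹ * t :=
    calc g * (s⁻¹ * t) * g⁻¹ = (g * s * g⁻¹)⁻¹ * (g * t * g⁻¹) := by group
      _ = s⁻¹ * t := by rw [h1, h2]; group
  exact mul_inv_eq_iff_eq_mul.mp h3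

/-- Representatives of distinct cosets of the center act by linearly independent operators. -/
theorem eq_zero_of_sum_smul_out_eq_zero {H W : Type*} [Group H] [AddCommGroup W] [Module ℂ W]
    [Nontrivial W] [Fintype (H ⧸ Subgroup.center H)]
    (hcomm : commutator H ≤ Subgroup.center H) (χ : Subgroup.center H →* ℂˣ)
    (hker : ∀ z : Subgroup.center H, (z : H) ∈ commutator H → χ z = 1 → z = 1)
    (σ : Representation ℂ H W)
    (hσ : ∀ (z : Subgroup.center H) (w : W), σ ↑z w = (χ z : ℂ) • w)
    (c : H ⧸ Subgroup.center H → ℂ) (hc : ∀ w, ∑ q, c q • σ q.out w = 0) : c = 0 := by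
  have hconj (h s : H) (w : W) :
      σ h (σ s (σ h⁻¹ w)) = commutatorCharacter hcomm χ s h • σ s w := by
    refine Eq.trans ?_ (hσ ⟨⁅h, s⁆, hcomm (commutatorElement_mem_commutator h s)⟩ (σ s w))
    simp only [← Module.End.mul_apply, ← map_mul]
    simp [commutatorElement_def, mul_assoc]
  have hindep : LinearIndependent ℂ fun q : H ⧸ Subgroup.center H ↦
      (commutatorCharacter hcomm χ q.out : H → ℂ) := by
    refine (linearIndependent_monoidHom H ℂ).comp
      (fun q : H ⧸ Subgroup.center H ↦ commutatorCharacter hcomm χ q.out) fun q r hqr ↦ ?_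
    simpa using mk_eq_mk_of_commutatorCharacter_eq hcomm χ hker hqr
  funext q
  obtain ⟨w, hw⟩ := exists_ne (0 : W)
  refine (smul_eq_zero_iff_left hw).mp
    ((Module.forall_dual_apply_eq_zero_iff ℂ (c q • w)).mp fun l ↦ ?_)
  have hsum : ∑ r : H ⧸ Subgroup.center H, l (c r • σ r.out (σ q.out⁻¹ w)) •
      (commutatorCharacter hcomm χ r.out : H → ℂ) = 0 := by
    funext h
    have := congrArg (fun x ↦ l (σ h x)) (hc (σ h⁻¹ (σ q.out⁻¹ w)))
    simp only [map_sum, map_smul, hconj, map_zero] at this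
    simpa [mul_comm, mul_left_comm, mul_assoc] using this
  simpa using Fintype.linearIndependent_iff.mp hindep _ hsum q

end

/-- Averaging a rank-one map over `H / Z(H)` can be arranged to give a nonzero intertwiner between
two representations with the same central character. -/
theorem exists_intertwiner_ne_zero {H V W : Type*} [Group H] [AddCommGroup V] [Module ℂ V]
    [AddCommGroup W] [Module ℂ W] [Nontrivial V] [Nontrivial W]
    [Fintype (H ⧸ Subgroup.center H)]
    (hcomm : commutator H ≤ Subgroup.center H) (χ : Subgroup.center H →* ℂˣ)
    (hker : ∀ z : Subgroup.center H, (z : H) ∈ commutator H → χ z = 1 → z = 1)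
    (ρ : Representation ℂ H V) (σ : Representation ℂ H W)
    (hρ : ∀ (z : Subgroup.center H) (v : V), ρ ↑z v = (χ z : ℂ) • v)
    (hσ : ∀ (z : Subgroup.center H) (w : W), σ ↑z w = (χ z : ℂ) • w) :
    ∃ A : V →ₗ[ℂ] W, (∀ h v, A (ρ h v) = σ h (A v)) ∧ A ≠ 0 := by
  let F (T : V →ₗ[ℂ] W) (h : H) : V →ₗ[ℂ] W := σ h ∘ₗ T ∘ₗ ρ h⁻¹
  have hF (T) {g h : H} (hgh : (g : H ⧸ Subgroup.center H) = h) : F T g = F T h := by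
    obtain ⟨z, rfl⟩ : ∃ z : Subgroup.center H, h = g * z :=
      ⟨⟨g⁻¹ * h, QuotientGroup.eq.mp hgh⟩, by simp⟩
    ext v
    have hinv : ρ (z : H)⁻¹ (ρ g⁻¹ v) = ((χ z)⁻¹ : ℂ) • ρ g⁻¹ v := by
      simpa using hρ z⁻¹ (ρ g⁻¹ v)
    simp [F, hinv, hσ, smul_smul]
  have hFmul (T) (g h : H) (v : V) : F T (g * h) (ρ g v) = σ g (F T h v) := by
    simp [F, ← Module.End.mul_apply, ← map_mul]
  let A (T : V →ₗ[ℂ] W) : V →ₗ[ℂ] W := ∑ q : H ⧸ Subgroup.center H, F T q.out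
  have hA (T) (h : H) (v : V) : A T (ρ h v) = σ h (A T v) := by
    simp only [A, LinearMap.sum_apply, map_sum, ← hFmul]
    refine (Fintype.sum_equiv (Equiv.mulLeft (h : H ⧸ Subgroup.center H)) _ _ fun q ↦ ?_).symm
    rw [hF T (g := h * q.out) (h := (Equiv.mulLeft (h : H ⧸ Subgroup.center H) q).out)]
    simp
  by_contra! hzero
  obtain ⟨v, hv⟩ := exists_ne (0 : V)
  refine hv ((Module.forall_dual_apply_eq_zero_iff ℂ v).mp fun φ ↦ ?_)
  let q₀ : H ⧸ Subgroup.center H := 1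
  have hc := eq_zero_of_sum_smul_out_eq_zero hcomm χ hker σ hσ
    (fun q ↦ φ (ρ q.out⁻¹ (ρ q₀.out v))) fun w ↦ by
      simpa [A, F] using DFunLike.congr_fun (hzero (A (φ.smulRight w)) (hA _)) (ρ q₀.out v)
  simpa using congrFun hc q₀

/-- **Statement 9** (Stone-von Neumann, uniqueness). Let `H` be a group whose commutator
subgroup is contained in its center and with `H/Z(H)` finite, and let `χ : Z(H) → ℂˣ` be a
homomorphism with `ker χ ∩ [H,H] = 1`. Then any two irreducible complex representations of
`H` on which `Z(H)` acts by the scalar `χ` are isomorphic as `H`-representations. -/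
theorem stone_von_neumann_uniqueness (H : Type) [Group H]
    (hcomm : commutator H ≤ Subgroup.center H)
    (hfin : Finite (H ⧸ Subgroup.center H))
    (χ : ↥(Subgroup.center H) →* ℂˣ)
    (hker : ∀ z : Subgroup.center H, (z : H) ∈ commutator H → χ z = 1 → z = 1)
    (V W : Type) [AddCommGroup V] [Module ℂ V] [AddCommGroup W] [Module ℂ W]
    (ρ : Representation ℂ H V) (σ : Representation ℂ H W)
    (hV0 : Nontrivial V) (hW0 : Nontrivial W)
    (hVirr : ∀ U : Submodule ℂ V, (∀ (h : H), ∀ v ∈ U, ρ h v ∈ U) → U = ⊥ ∨ U = ⊤)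
    (hWirr : ∀ U : Submodule ℂ W, (∀ (h : H), ∀ w ∈ U, σ h w ∈ U) → U = ⊥ ∨ U = ⊤)
    (hVcent : ∀ (z : Subgroup.center H) (v : V), ρ ↑z v = (χ z : ℂ) • v)
    (hWcent : ∀ (z : Subgroup.center H) (w : W), σ ↑z w = (χ z : ℂ) • w) :
    ∃ e : V ≃ₗ[ℂ] W, ∀ (h : H) (v : V), e (ρ h v) = σ h (e v) := by
  have := Fintype.ofFinite (H ⧸ Subgroup.center H)
  obtain ⟨A, hA, hA0⟩ := exists_intertwiner_ne_zero hcomm χ hker ρ σ hVcent hWcent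
  have hker' : LinearMap.ker A = ⊥ := by
    refine (hVirr (LinearMap.ker A) fun h v hv ↦ ?_).resolve_right
      fun h ↦ hA0 (LinearMap.ker_eq_top.mp h)
    rw [LinearMap.mem_ker] at hv ⊢
    rw [hA, hv, map_zero]
  have hrange : LinearMap.range A = ⊤ := by
    refine (hWirr (LinearMap.range A) ?_).resolve_left fun h ↦ hA0 (LinearMap.range_eq_bot.mp h)
    rintro h _ ⟨v, rfl⟩
    exact ⟨ρ h v, hA h v⟩
  exact ⟨LinearEquiv.ofBijective A
    ⟨LinearMap.ker_eq_bot.mp hker', LinearMap.range_eq_top.mp hrange⟩, hA⟩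
end
end

section
/- Let l ≥ 1, let K = GL₂(O), K_l = {g ∈ GL₂(O) : g ≡ I₂ mod p^l}, let B ∩ K be the subgroup of upper-triangular matrices in GL₂(O), and set B_l = (B ∩ K)·K_l. Then the set {I₂, w} ∪ {lt(ϖ^r) : 1 ≤ r < l}, where w = [[0,1],[−1,0]] and lt(x) = [[1,0],[x,1]], is a complete set of representatives for the double cosets B_l\GL₂(O)/B_l: these l + 1 double cosets are pairwise disjoint and their union is GL₂(O). In particular, for a fixed non-square unit ε and 1 ≤ r < l, lt(εϖ^r) lies in the double coset B_l · lt(ϖ^r) · B_l. -/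
noncomputable section
open scoped Classical

structure LFD : Type 1 where
  F : Type
  [fieldF : Field F]
  A : Subring F
  v : F → ℤ
  κ : Type
  [fieldκ : Field κ]
  [fintypeκ : Fintype κ]
  res : A →+* κ
  q : ℕ
  ϖ : A
  hA : ∀ x : F, x ∈ A ↔ x = 0 ∨ 0 ≤ v x
  hv1 : ∀ x y : F, x ≠ 0 → y ≠ 0 → v (x * y) = v x + v y
  hv2 : ∀ x y : F, x ≠ 0 → y ≠ 0 → x + y ≠ 0 → min (v x) (v y) ≤ v (x + y)
  hϖ1 : v ↑ϖ = 1
  hϖ0 : (ϖ : F) ≠ 0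
  hres : Function.Surjective res
  hresker : ∀ x : A, res x = 0 ↔ ((x : F) = 0 ∨ 0 < v ↑x)
  hq : Fintype.card κ = q
  hensel : ∀ f : Polynomial A, f.Monic → ∀ a₀ : A,
      res (f.eval a₀) = 0 → res ((Polynomial.derivative f).eval a₀) ≠ 0 →
      ∃ a : A, f.eval a = 0 ∧ res (a - a₀) = 0

attribute [instance] LFD.fieldF LFD.fieldκ LFD.fintypeκ

/-- membership in `𝔭^j` (`x = 0` allowed) -/
def inP (D : LFD) (x : D.F) (j : ℕ) : Prop := x = 0 ∨ (j : ℤ) ≤ D.v x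


variable (D : LFD)

/-- the Weyl element `w = [[0,1],[-1,0]]` in `GL₂(O)` -/
def wGL : GL (Fin 2) ↥D.A :=
  ⟨!![0, 1; -1, 0], !![0, -1; 1, 0],
    by rw [Matrix.mul_fin_two, Matrix.one_fin_two]; norm_num,
    by rw [Matrix.mul_fin_two, Matrix.one_fin_two]; norm_num⟩

/-- the lower-triangular unipotent element `lt(x) = [[1,0],[x,1]]` in `GL₂(O)` -/
def ltGL (x : ↥D.A) : GL (Fin 2) ↥D.A :=
  ⟨!![1, 0; x, 1], !![1, 0; -x, 1],
    by rw [Matrix.mul_fin_two, Matrix.one_fin_two]; norm_num,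
    by rw [Matrix.mul_fin_two, Matrix.one_fin_two]; norm_num⟩

/-- the principal congruence subgroup `K_l` of `GL₂(O)`, as a set -/
def KlGL (l : ℕ) : Set (GL (Fin 2) ↥D.A) :=
  {g | ∀ a b : Fin 2, inP D (↑(Units.val g a b) - ↑((1 : Matrix (Fin 2) (Fin 2) ↥D.A) a b)) l}

/-- `B ∩ K`: the integral upper-triangular matrices in `GL₂(O)`, as a set -/
def BKGL : Set (GL (Fin 2) ↥D.A) := {g | Units.val g 1 0 = 0}

/-- `B_l = (B ∩ K) · K_l`, as a set -/
def BlGL (l : ℕ) : Set (GL (Fin 2) ↥D.A) :=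
  {x | ∃ b ∈ BKGL D, ∃ k ∈ KlGL D l, x = b * k}

/-- `y` lies in the double coset `B_l x B_l` -/
def drel (l : ℕ) (x y : GL (Fin 2) ↥D.A) : Prop :=
  ∃ b ∈ BlGL D l, ∃ b' ∈ BlGL D l, y = b * x * b'

namespace LFD

variable {D : LFD}

lemma v_one : D.v 1 = 0 := by
  have h := D.hv1 1 1 one_ne_zero one_ne_zero
  rw [mul_one] at h
  omega

lemma v_pi_pow (n : ℕ) : D.v ((D.ϖ : D.F) ^ n) = n := by
  induction n with
  | zero => simpa using D.v_one
  | succ n ih =>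
    rw [pow_succ, D.hv1 _ _ (pow_ne_zero _ D.hϖ0) D.hϖ0, ih, D.hϖ1]
    push_cast
    ring

lemma v_nonneg {x : D.A} (hx : x ≠ 0) : 0 ≤ D.v x :=
  ((D.hA x).1 x.2).resolve_left fun h => hx (Subtype.ext h)

lemma pi_pow_dvd_iff (n : ℕ) (x : D.A) : D.ϖ ^ n ∣ x ↔ inP D x n := by
  constructor
  · rintro ⟨y, rfl⟩
    by_cases hy : y = 0
    · exact Or.inl (by simp [hy])
    · right
      have hy' : (y : D.F) ≠ 0 := fun h => hy (Subtype.ext h)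
      push_cast
      rw [D.hv1 _ _ (pow_ne_zero _ D.hϖ0) hy', v_pi_pow]
      linarith [v_nonneg hy]
  · intro h
    by_cases hx : (x : D.F) = 0
    · rw [show x = 0 from Subtype.ext hx]
      exact dvd_zero _
    · have hn := h.resolve_left hx
      have hp : (D.ϖ : D.F) ^ n ≠ 0 := pow_ne_zero _ D.hϖ0
      have hxy : (D.ϖ : D.F) ^ n * (x / (D.ϖ : D.F) ^ n) = x := mul_div_cancel₀ _ hp
      have hv := D.hv1 _ _ hp (div_ne_zero hx hp)
      rw [hxy, v_pi_pow] at hv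
      refine ⟨⟨x / (D.ϖ : D.F) ^ n, (D.hA _).2 (Or.inr (by linarith))⟩, Subtype.ext ?_⟩
      push_cast
      exact hxy.symm

lemma isUnit_of_v_eq_zero {x : D.A} (hx : (x : D.F) ≠ 0) (hv : D.v x = 0) : IsUnit x := by
  have hxy : (x : D.F) * (x : D.F)⁻¹ = 1 := mul_inv_cancel₀ hx
  have h := D.hv1 _ _ hx (inv_ne_zero hx)
  rw [hxy, v_one] at h
  exact IsUnit.of_mul_eq_one ⟨(x : D.F)⁻¹, (D.hA _).2 (Or.inr (by linarith))⟩ (Subtype.ext hxy)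

lemma isUnit_of_res_ne_zero {x : D.A} (h : D.res x ≠ 0) : IsUnit x := by
  have hx := mt (D.hresker x).2 h
  push Not at hx
  exact isUnit_of_v_eq_zero hx.1 (le_antisymm hx.2 (v_nonneg fun h => hx.1 (by simp [h])))

lemma res_pi : D.res D.ϖ = 0 :=
  (D.hresker _).2 (Or.inr (by rw [D.hϖ1]; exact one_pos))

lemma pi_not_isUnit : ¬ IsUnit D.ϖ := fun h =>
  (h.map D.res).ne_zero res_pi

lemma pi_pow_dvd_pi_pow_iff {m n : ℕ} : D.ϖ ^ m ∣ D.ϖ ^ n ↔ m ≤ n :=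
  pow_dvd_pow_iff (fun h => D.hϖ0 (by simp [h])) pi_not_isUnit

lemma exists_unit_mul_pi_pow {x : D.A} (hx : x ≠ 0) :
    ∃ (n : ℕ) (u : D.Aˣ), x = u * D.ϖ ^ n := by
  have hx' : (x : D.F) ≠ 0 := fun h => hx (Subtype.ext h)
  have hv : ((D.v x).toNat : ℤ) = D.v x := Int.toNat_of_nonneg (v_nonneg hx)
  obtain ⟨y, hy⟩ := (pi_pow_dvd_iff (D.v x).toNat x).2 (Or.inr hv.le)
  have hyF : (x : D.F) = (D.ϖ : D.F) ^ (D.v x).toNat * y := by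
    simpa using congrArg Subtype.val hy
  have hy0 : (y : D.F) ≠ 0 := fun h => hx' (by rw [hyF, h, mul_zero])
  have h := D.hv1 _ _ (pow_ne_zero (D.v x).toNat D.hϖ0) hy0
  rw [← hyF, v_pi_pow, hv] at h
  obtain ⟨u, rfl⟩ := isUnit_of_v_eq_zero hy0 (by linarith)
  exact ⟨_, u, by rw [mul_comm]; exact hy⟩

lemma isUnit_det (g : GL (Fin 2) D.A) : IsUnit (g.val 0 0 * g.val 1 1 - g.val 0 1 * g.val 1 0) := by
  rw [← Matrix.det_fin_two]
  exact (Matrix.isUnit_iff_isUnit_det _).1 g.isUnit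

lemma isUnit_diag {g : GL (Fin 2) D.A} (h : D.ϖ ∣ g.val 1 0) :
    IsUnit (g.val 0 0) ∧ IsUnit (g.val 1 1) := by
  obtain ⟨c, hc⟩ := h
  have hdet := ((isUnit_det g).map D.res).ne_zero
  rw [hc] at hdet
  simp only [map_sub, map_mul, res_pi, zero_mul, mul_zero, sub_zero] at hdet
  exact ⟨isUnit_of_res_ne_zero (left_ne_zero_of_mul hdet),
    isUnit_of_res_ne_zero (right_ne_zero_of_mul hdet)⟩

end LFD

open LFD

variable {D}

lemma one_mem_KlGL (l : ℕ) : (1 : GL (Fin 2) D.A) ∈ KlGL D l := fun a b =>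
  Or.inl (by simp)

lemma BKGL_subset_BlGL (l : ℕ) : BKGL D ⊆ BlGL D l := fun b hb =>
  ⟨b, hb, 1, one_mem_KlGL l, (mul_one b).symm⟩

lemma GL_mul_apply (g h : GL (Fin 2) D.A) (i j : Fin 2) :
    (g * h).val i j = g.val i 0 * h.val 0 j + g.val i 1 * h.val 1 j := by
  rw [Units.val_mul, Matrix.mul_apply, Fin.sum_univ_two]

lemma ltGL_mul_neg (x : D.A) : ltGL D (-x) * ltGL D x = 1 := by
  ext i j
  rw [GL_mul_apply]
  fin_cases i <;> fin_cases j <;> simp [ltGL]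

lemma ltGL_mem_KlGL {l : ℕ} {x : D.A} (hx : D.ϖ ^ l ∣ x) : ltGL D x ∈ KlGL D l := by
  intro a b
  fin_cases a <;> fin_cases b
  · exact Or.inl (by simp [ltGL])
  · exact Or.inl (by simp [ltGL])
  · simpa [ltGL] using (pi_pow_dvd_iff l x).1 hx
  · exact Or.inl (by simp [ltGL])

lemma mem_BlGL_iff {l : ℕ} (hl : 1 ≤ l) (g : GL (Fin 2) D.A) :
    g ∈ BlGL D l ↔ D.ϖ ^ l ∣ g.val 1 0 := by
  constructor
  · rintro ⟨b, hb, k, hk, rfl⟩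
    have hk' := hk 1 0
    have hb' : b.val 1 0 = 0 := hb
    rw [GL_mul_apply, hb', zero_mul, zero_add]
    refine Dvd.dvd.mul_left ((pi_pow_dvd_iff l _).2 ?_) _
    simpa using hk'
  · intro h
    obtain ⟨d, hd⟩ := (isUnit_diag (dvd_trans (dvd_pow_self _ (by omega)) h)).2
    refine ⟨g * ltGL D (-(↑d⁻¹ * g.val 1 0)), ?_, ltGL D (↑d⁻¹ * g.val 1 0),
      ltGL_mem_KlGL (h.mul_left _), by rw [mul_assoc, ltGL_mul_neg, mul_one]⟩
    change (g * ltGL D (-(↑d⁻¹ * g.val 1 0))).val 1 0 = 0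
    rw [GL_mul_apply, ← hd]
    simp [ltGL]

/-- For `n ≤ l`, divisibility of the lower-left entry by `ϖ ^ n` is constant on the
double cosets of `B_l`. -/
lemma drel.pi_pow_dvd_iff {l n : ℕ} (hl : 1 ≤ l) (hn : n ≤ l) {x y : GL (Fin 2) D.A}
    (h : drel D l x y) : D.ϖ ^ n ∣ x.val 1 0 ↔ D.ϖ ^ n ∣ y.val 1 0 := by
  obtain ⟨b, hb, b', hb', rfl⟩ := h
  rw [mem_BlGL_iff hl] at hb hb'
  have hϖ : D.ϖ ∣ D.ϖ ^ l := dvd_pow_self _ (by omega)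
  have hu : IsUnit (b.val 1 1 * b'.val 0 0) :=
    (isUnit_diag (hϖ.trans hb)).2.mul (isUnit_diag (hϖ.trans hb')).1
  have hnl := pow_dvd_pow D.ϖ hn
  have key : (b * x * b').val 1 0 = b.val 1 1 * b'.val 0 0 * x.val 1 0 +
      (b.val 1 0 * (x.val 0 0 * b'.val 0 0) +
        b'.val 1 0 * (b.val 1 0 * x.val 0 1 + b.val 1 1 * x.val 1 1)) := by
    simp only [GL_mul_apply]
    ring
  rw [key, dvd_add_left (dvd_add ((hnl.trans hb).mul_right _) ((hnl.trans hb').mul_right _)),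
    hu.dvd_mul_left]

/-- The upper triangular matrix `[[s, t], [0, 1]]`. -/
def upperGL (s : D.Aˣ) (t : D.A) : GL (Fin 2) D.A :=
  ⟨!![s, t; 0, 1], !![↑s⁻¹, -(↑s⁻¹ * t); 0, 1],
    by rw [Matrix.mul_fin_two, Matrix.one_fin_two]; simp,
    by rw [Matrix.mul_fin_two, Matrix.one_fin_two]; simp⟩

lemma upperGL_inv_val (s : D.Aˣ) (t : D.A) :
    (upperGL s t)⁻¹.val = !![↑s⁻¹, -(↑s⁻¹ * t); 0, 1] := rfl

lemma wGL_inv_val : (wGL D)⁻¹.val = !![0, -1; 1, 0] := rfl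

lemma ltGL_inv_val (x : D.A) : (ltGL D x)⁻¹.val = !![1, 0; -x, 1] := rfl

lemma drel_of_upperGL (l : ℕ) {x g : GL (Fin 2) D.A} (s : D.Aˣ) (t : D.A)
    (h : (g * (upperGL s t)⁻¹ * x⁻¹).val 1 0 = 0) : drel D l x g :=
  ⟨_, BKGL_subset_BlGL l h, upperGL s t, BKGL_subset_BlGL l rfl, by group⟩

lemma drel_wGL (l : ℕ) {g : GL (Fin 2) D.A} (h : IsUnit (g.val 1 0)) :
    drel D l (wGL D) g := by
  obtain ⟨c, hc⟩ := h
  refine drel_of_upperGL l 1 (↑c⁻¹ * g.val 1 1) ?_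
  simp only [GL_mul_apply, ← hc, upperGL_inv_val, wGL_inv_val]
  simp

lemma drel_ltGL {l r : ℕ} (hr : 1 ≤ r) {g : GL (Fin 2) D.A} {u : D.Aˣ}
    (h : g.val 1 0 = u * D.ϖ ^ r) : drel D l (ltGL D (D.ϖ ^ r)) g := by
  obtain ⟨d, hd⟩ := (isUnit_diag (h ▸ (dvd_pow_self _ (by omega)).mul_left _)).2
  refine drel_of_upperGL l (u * d⁻¹) 0 ?_
  simp only [GL_mul_apply, ← hd, h, upperGL_inv_val, ltGL_inv_val]
  have hu : (u * D.ϖ ^ r * (d * ↑u⁻¹) : D.A) = d * D.ϖ ^ r * (u * ↑u⁻¹) := by ring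
  simp [hu]

/-- **Statement 19.** Let `l ≥ 1`. The set `{I₂, w} ∪ {lt(ϖ^r) : 1 ≤ r < l}`, where
`w = [[0,1],[-1,0]]` and `lt(x) = [[1,0],[x,1]]`, is a complete set of representatives for
the double cosets `B_l \ GL₂(O) / B_l` (with `B_l = (B ∩ K)·K_l`): their double cosets are
pairwise disjoint and their union is `GL₂(O)`. In particular, for a fixed non-square unit
`ε` and `1 ≤ r < l`, `lt(ε ϖ^r)` lies in the double coset `B_l ⬝ lt(ϖ^r) ⬝ B_l`. -/
theorem double_coset_reps_GL2 (D : LFD) (l : ℕ) (hl : 1 ≤ l) (εu : ↥D.A) (hε1 : D.v ↑εu = 0)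
    (hε2 : ¬ ∃ y : D.F, y ^ 2 = ↑εu) :
    (∀ g : GL (Fin 2) ↥D.A, ∃ x : GL (Fin 2) ↥D.A,
      (x = 1 ∨ x = wGL D ∨ ∃ r : ℕ, 1 ≤ r ∧ r < l ∧ x = ltGL D (D.ϖ ^ r)) ∧
      drel D l x g) ∧
    (¬ drel D l 1 (wGL D)) ∧
    (∀ r : ℕ, 1 ≤ r → r < l →
      ¬ drel D l 1 (ltGL D (D.ϖ ^ r)) ∧ ¬ drel D l (wGL D) (ltGL D (D.ϖ ^ r))) ∧
    (∀ r s : ℕ, 1 ≤ r → r < l → 1 ≤ s → s < l → r ≠ s →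
      ¬ drel D l (ltGL D (D.ϖ ^ r)) (ltGL D (D.ϖ ^ s))) ∧
    (∀ r : ℕ, 1 ≤ r → r < l →
      drel D l (ltGL D (D.ϖ ^ r)) (ltGL D (εu * D.ϖ ^ r))) := by
  have lt_dvd {r n : ℕ} : D.ϖ ^ n ∣ (ltGL D (D.ϖ ^ r)).val 1 0 ↔ n ≤ r :=
    pi_pow_dvd_pi_pow_iff
  have one_dvd (n : ℕ) : D.ϖ ^ n ∣ (1 : GL (Fin 2) D.A).val 1 0 := by simp
  have w_dvd {n : ℕ} (hn : 1 ≤ n) : ¬ D.ϖ ^ n ∣ (wGL D).val 1 0 := fun h =>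
    pi_not_isUnit (isUnit_of_dvd_unit ((dvd_pow_self _ (by omega)).trans h)
      (isUnit_one.neg : IsUnit (-1 : D.A)))
  refine ⟨fun g => ?_, fun h => ?_, fun r hr hrl => ⟨fun h => ?_, fun h => ?_⟩,
    fun r s hr hrl hs hsl hrs h => ?_, fun r hr hrl => ?_⟩
  · by_cases hg : D.ϖ ^ l ∣ g.val 1 0
    · exact ⟨1, Or.inl rfl, g, (mem_BlGL_iff hl g).2 hg, 1, (mem_BlGL_iff hl 1).2 (one_dvd l),
        by group⟩
    obtain ⟨r, u, hu⟩ := exists_unit_mul_pi_pow (x := g.val 1 0) (fun h => hg (h ▸ dvd_zero _))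
    rcases Nat.eq_zero_or_pos r with rfl | hr
    · exact ⟨wGL D, Or.inr (Or.inl rfl), drel_wGL l (by rw [hu]; simp)⟩
    · have hrl : r < l := by
        by_contra! hlr
        exact hg (hu ▸ (pow_dvd_pow D.ϖ hlr).mul_left _)
      exact ⟨_, Or.inr (Or.inr ⟨r, hr, hrl, rfl⟩), drel_ltGL hr hu⟩
  · exact w_dvd hl ((h.pi_pow_dvd_iff hl le_rfl).1 (one_dvd l))
  · exact absurd (lt_dvd.1 ((h.pi_pow_dvd_iff hl le_rfl).1 (one_dvd l))) (by omega)
  · exact w_dvd le_rfl ((h.pi_pow_dvd_iff hl hl).2 (lt_dvd.2 hr))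
  · exact hrs (le_antisymm (lt_dvd.1 ((h.pi_pow_dvd_iff hl hrl.le).1 (lt_dvd.2 le_rfl)))
      (lt_dvd.1 ((h.pi_pow_dvd_iff hl hsl.le).2 (lt_dvd.2 le_rfl))))
  · have hε : (εu : D.F) ≠ 0 := fun h => hε2 ⟨0, by simp [h]⟩
    obtain ⟨u, rfl⟩ := isUnit_of_v_eq_zero hε hε1
    exact drel_ltGL hr rfl
end
end
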